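/- arXiv:1801.01017 — 5 statements merged into one kernel-verified Lean document; each statement's English description precedes it below -/
import Mathlib

section
/- Let r* > 0 and let φ : ℝ → ℝ satisfy φ(r) = 0 for all r ≥ r*. Let I_ℓ ⊆ {1, …, N} and let x : [0, ∞) → (ℝ^M)^N be a solution of the particle dynamics such that for every t ≥ 0, ‖x_k(t) − x_j(t)‖ ≥ r* whenever k ∈ I_ℓ and j ∉ I_ℓ. Then the mean of the cluster ℓ is constant in time: for all t ≥ 0, (1/|I_ℓ|) Σ_{j ∈ I_ℓ} x_j(t) = (1/|I_ℓ|) Σ_{j ∈ I_ℓ} x_j(0). -/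
open Finset

/-- A double sum of an antisymmetric family over a square index set vanishes. -/
theorem sum_sum_eq_zero_of_antisymm {ι E : Type*} [AddCommGroup E] [Module ℝ E]
    (s : Finset ι) (f : ι → ι → E) (hf : ∀ i j, f i j = -f j i) :
    ∑ i ∈ s, ∑ j ∈ s, f i j = 0 := by
  have h : ∑ i ∈ s, ∑ j ∈ s, f i j = -∑ i ∈ s, ∑ j ∈ s, f i j := by
    conv_lhs => rw [Finset.sum_comm]
    simp only [← Finset.sum_neg_distrib]
    exact Finset.sum_congr rfl fun i _ => Finset.sum_congr rfl fun j _ => hf j i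
  have h2 : (2 : ℝ) • ∑ i ∈ s, ∑ j ∈ s, f i j = 0 := by
    rw [two_smul]
    exact add_eq_zero_iff_eq_neg.mpr h
  exact (smul_eq_zero_iff_right two_ne_zero).mp h2

/-- If a cluster I_ℓ remains at distance at least r* from all other particles
for all time, then the mean of the cluster is constant in time. -/
theorem cluster_mean_invariant
    {N M : ℕ}
    (rstar : ℝ) (hrstar : 0 < rstar)
    (φ : ℝ → ℝ)
    (hφzero : ∀ r : ℝ, rstar ≤ r → φ r = 0)
    (I : Finset (Fin N))
    (x : ℝ → Fin N → EuclideanSpace ℝ (Fin M))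
    (hsol : ∀ t : ℝ, 0 ≤ t → ∀ k : Fin N,
      HasDerivAt (fun s => x s k)
        (∑ j : Fin N, φ ‖x t k - x t j‖ • (x t j - x t k)) t)
    (hsep : ∀ t : ℝ, 0 ≤ t → ∀ k ∈ I, ∀ j ∉ I, rstar ≤ ‖x t k - x t j‖) :
    ∀ t : ℝ, 0 ≤ t →
      (I.card : ℝ)⁻¹ • ∑ j ∈ I, x t j = (I.card : ℝ)⁻¹ • ∑ j ∈ I, x 0 j := by
  have hderiv : ∀ t : ℝ, 0 ≤ t → HasDerivAt (fun s => ∑ k ∈ I, x s k) 0 t := by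
    intro t ht
    have hsum : ∑ k ∈ I, ∑ j : Fin N, φ ‖x t k - x t j‖ • (x t j - x t k) = 0 := by
      rw [← sum_sum_eq_zero_of_antisymm I
        (fun k j => φ ‖x t k - x t j‖ • (x t j - x t k))
        (fun k j => by rw [norm_sub_rev, ← smul_neg, neg_sub])]
      refine Finset.sum_congr rfl fun k hk => ?_
      refine (Finset.sum_subset (Finset.subset_univ I) fun j _ hj => ?_).symm
      rw [hφzero _ (hsep t ht k hk j hj), zero_smul]
    rw [← hsum]
    exact HasDerivAt.fun_sum fun k _ => hsol t ht k
  intro t ht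
  congr 1
  exact constant_of_has_deriv_right_zero
    (fun s hs => (hderiv s hs.1).continuousAt.continuousWithinAt)
    (fun s hs => (hderiv s hs.1).hasDerivWithinAt) t ⟨ht, le_rfl⟩
end

section
/- Let r* > 0 and let φ : ℝ → ℝ be continuous with: 0 ≤ φ(r) ≤ 1 for all r ≥ 0; φ(r) = 0 for r ≥ r*; φ(r) > 0 for 0 ≤ r < r*; and φ nonincreasing on [0, r*]. Let z_1, …, z_N ∈ ℝ^M be data points partitioned into P nonempty clusters with index sets I_1, …, I_P satisfying: ‖z_i − z_k‖ > r* whenever i and k lie in different clusters, and ‖z_i − z_j‖ < r* whenever i and j lie in the same cluster. Let x : [0, ∞) → (ℝ^M)^N be a solution of the particle dynamics with x_j(0) = z_j for all j, and suppose that for every t ≥ 0, ‖x_k(t) − x_j(t)‖ ≥ r* whenever k and j lie in different clusters. Then every particle converges to the mean of its initial cluster: for every ℓ and every j ∈ I_ℓ, lim_{t → ∞} x_j(t) = (1/|I_ℓ|) Σ_{k ∈ I_ℓ} z_k. -/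
open Finset Filter

/-- Maximum principle: if every member of a finite family of differentiable functions has a
nonpositive derivative whenever it is the largest one, upper bounds at time `0` persist. -/
theorem le_of_deriv_nonpos_of_isMax {ι : Type*} [Finite ι] {f f' : ι → ℝ → ℝ} {C : ℝ}
    (hf : ∀ i t, 0 ≤ t → HasDerivAt (f i) (f' i t) t)
    (hmax : ∀ i t, 0 ≤ t → (∀ j, f j t ≤ f i t) → f' i t ≤ 0)
    (h0 : ∀ i, f i 0 ≤ C) {t : ℝ} (ht : 0 ≤ t) (i : ι) : f i t ≤ C := by
  have key : ∀ ε : ℝ, 0 < ε → f i t ≤ C + ε * t := by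
    intro ε hε
    have hsub : Set.Icc 0 t ⊆ {s | ∀ j, f j s ≤ C + ε * s} := by
      apply IsClosed.Icc_subset_of_forall_mem_nhdsWithin
      · have hset : {s | ∀ j, f j s ≤ C + ε * s} ∩ Set.Icc 0 t =
            Set.Icc 0 t ∩ ⋂ j, {s ∈ Set.Icc 0 t | f j s ≤ C + ε * s} := by
          ext s
          simp only [Set.mem_inter_iff, Set.mem_ofPred_eq, Set.mem_iInter]
          exact ⟨fun h => ⟨h.2, fun j => ⟨h.2, h.1 j⟩⟩, fun h => ⟨fun j => (h.2 j).2, h.1⟩⟩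
        rw [hset]
        refine isClosed_Icc.inter (isClosed_iInter fun j => ?_)
        exact isClosed_Icc.isClosed_le
          (fun s hs => (hf j s hs.1).continuousAt.continuousWithinAt) (by fun_prop)
      · simpa using h0
      · rintro s ⟨hs, hs0, -⟩
        refine eventually_all.2 fun j => ?_
        rcases (hs j).lt_or_eq with hlt | heq
        · have hc : ContinuousAt (fun r => C + ε * r) s := by fun_prop
          exact nhdsWithin_le_nhds
            (((hf j s hs0).continuousAt.eventually_lt hc hlt).mono fun _ h => h.le)
        · have hle : f' j s ≤ 0 := hmax j s hs0 fun k => heq ▸ hs k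
          have hslope := (hasDerivAt_iff_tendsto_slope.1 (hf j s hs0)).mono_left
            (nhdsWithin_mono s fun r (hr : s < r) => hr.ne')
          filter_upwards [hslope.eventually_lt_const (hle.trans_lt hε), self_mem_nhdsWithin]
            with r hr hsr
          have hpos : 0 < r - s := sub_pos.2 hsr
          rw [slope_def_field, div_lt_iff₀ hpos] at hr
          linarith
    exact hsub ⟨ht, le_rfl⟩ i
  refine le_of_forall_pos_le_add fun δ hδ => ?_
  have h1 : 0 < t + 1 := by linarith
  refine (key (δ / (t + 1)) (by positivity)).trans ?_
  have : δ / (t + 1) * t ≤ δ := by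
    rw [div_mul_eq_mul_div, div_le_iff₀ h1]
    nlinarith
  linarith

section InnerProductSpace

variable {E : Type*} [NormedAddCommGroup E] [InnerProductSpace ℝ E] {ι : Type*} [Fintype ι]

/-- The point `u` of a diametral pair `u, v` moves towards `v` when pulled towards any `w` in the
ball of radius `‖u - v‖` around `v`. -/
theorem inner_sub_sub_nonpos_of_norm_le {u v w : E} (h : ‖w - v‖ ≤ ‖u - v‖) :
    inner ℝ (u - v) (w - u) ≤ 0 := by
  have h1 : w - u = (w - v) - (u - v) := by abel
  have h2 := real_inner_le_norm (u - v) (w - v)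
  rw [h1, inner_sub_right, real_inner_self_eq_norm_sq]
  nlinarith [norm_nonneg (u - v)]

theorem sum_sum_smul_sub_eq_zero {a : ι → ι → ℝ} (ha : ∀ k j, a k j = a j k) (u : ι → E) :
    ∑ k, ∑ j, a k j • (u j - u k) = 0 := by
  simp only [smul_sub, sum_sub_distrib]
  rw [sub_eq_zero, sum_comm]
  exact sum_congr rfl fun k _ => sum_congr rfl fun j _ => by rw [ha]

theorem two_mul_sum_inner_sum_smul_sub {a : ι → ι → ℝ} (ha : ∀ k j, a k j = a j k) (u : ι → E) :
    2 * ∑ k, inner ℝ (u k) (∑ j, a k j • (u j - u k)) =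
      -∑ k, ∑ j, a k j * ‖u k - u j‖ ^ 2 := by
  have hexp : ∑ k, inner ℝ (u k) (∑ j, a k j • (u j - u k)) =
      ∑ k, ∑ j, a k j * inner ℝ (u k) (u j - u k) := by
    simp only [inner_sum, inner_smul_right]
  have hswap : ∑ k, ∑ j, a k j * inner ℝ (u k) (u j - u k) =
      ∑ k, ∑ j, a k j * inner ℝ (u j) (u k - u j) := by
    rw [sum_comm]
    exact sum_congr rfl fun k _ => sum_congr rfl fun j _ => by rw [ha]
  rw [two_mul, hexp]
  nth_rewrite 2 [hswap]
  simp only [← sum_add_distrib, ← sum_neg_distrib]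
  refine sum_congr rfl fun k _ => sum_congr rfl fun j _ => ?_
  rw [norm_sub_sq_real, inner_sub_right, inner_sub_right, real_inner_self_eq_norm_sq,
    real_inner_self_eq_norm_sq, real_inner_comm (u k) (u j)]
  ring

theorem sum_sum_norm_sub_sq_of_sum_eq_zero {u : ι → E} (hu : ∑ k, u k = 0) :
    ∑ k, ∑ j, ‖u k - u j‖ ^ 2 = 2 * Fintype.card ι * ∑ k, ‖u k‖ ^ 2 := by
  simp only [norm_sub_sq_real, sum_add_distrib, sum_sub_distrib, ← mul_sum, ← inner_sum, hu,
    inner_zero_right, sum_const, card_univ, nsmul_eq_mul]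
  ring

variable {φ : ℝ → ℝ} {y : ℝ → ι → E}

theorem norm_sub_le_of_particle_dynamics (hφ : ∀ r, 0 ≤ r → 0 ≤ φ r)
    (hy : ∀ t, 0 ≤ t → ∀ k,
      HasDerivAt (fun s => y s k) (∑ j, φ ‖y t k - y t j‖ • (y t j - y t k)) t)
    {d : ℝ} (hd : ∀ k j, ‖y 0 k - y 0 j‖ ≤ d) {t : ℝ} (ht : 0 ≤ t) (k j : ι) :
    ‖y t k - y t j‖ ≤ d := by
  have hd0 : 0 ≤ d := (norm_nonneg _).trans (hd k j)
  have hsq := le_of_deriv_nonpos_of_isMax (C := d ^ 2)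
    (f := fun (p : ι × ι) s => ‖y s p.1 - y s p.2‖ ^ 2)
    (hf := fun p s hs => ((hy s hs p.1).sub (hy s hs p.2)).norm_sq) ?_
    (fun p => pow_le_pow_left₀ (norm_nonneg _) (hd p.1 p.2) 2) ht (k, j)
  · exact le_of_sq_le_sq hsq hd0
  · rintro ⟨p, q⟩ s - hmax
    have hpq : ∀ i l, ‖y s i - y s l‖ ≤ ‖y s p - y s q‖ := fun i l =>
      le_of_sq_le_sq (hmax (i, l)) (norm_nonneg _)
    have h1 : inner ℝ (y s p - y s q) (∑ i, φ ‖y s p - y s i‖ • (y s i - y s p)) ≤ 0 := by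
      rw [inner_sum]
      refine sum_nonpos fun i _ => ?_
      rw [inner_smul_right]
      exact mul_nonpos_of_nonneg_of_nonpos (hφ _ (norm_nonneg _))
        (inner_sub_sub_nonpos_of_norm_le (hpq i q))
    have h2 : inner ℝ (y s q - y s p) (∑ i, φ ‖y s q - y s i‖ • (y s i - y s q)) ≤ 0 := by
      rw [inner_sum]
      refine sum_nonpos fun i _ => ?_
      rw [inner_smul_right]
      refine mul_nonpos_of_nonneg_of_nonpos (hφ _ (norm_nonneg _))
        (inner_sub_sub_nonpos_of_norm_le ?_)
      rw [norm_sub_rev (y s q)]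
      exact hpq i p
    rw [← neg_sub (y s p), inner_neg_left] at h2
    simp only [Pi.sub_apply]
    rw [inner_sub_right]
    linarith

theorem sum_eq_of_particle_dynamics
    (hy : ∀ t, 0 ≤ t → ∀ k,
      HasDerivAt (fun s => y s k) (∑ j, φ ‖y t k - y t j‖ • (y t j - y t k)) t)
    {t : ℝ} (ht : 0 ≤ t) : ∑ k, y t k = ∑ k, y 0 k := by
  have hder : ∀ s, 0 ≤ s → HasDerivAt (fun s => ∑ k, y s k) 0 s := fun s hs => by
    have h := HasDerivAt.fun_sum (u := univ) fun k _ => hy s hs k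
    rwa [sum_sum_smul_sub_eq_zero (fun k j => by rw [norm_sub_rev])] at h
  exact constant_of_has_deriv_right_zero
    (fun s hs => (hder s hs.1).continuousAt.continuousWithinAt)
    (fun s hs => (hder s hs.1).hasDerivWithinAt) t ⟨ht, le_rfl⟩

theorem sum_norm_sub_mean_sq_le_of_particle_dynamics {m : E} {c : ℝ}
    (hy : ∀ t, 0 ≤ t → ∀ k,
      HasDerivAt (fun s => y s k) (∑ j, φ ‖y t k - y t j‖ • (y t j - y t k)) t)
    (hm : ∀ t, 0 ≤ t → ∑ k, (y t k - m) = 0)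
    (hc : ∀ t, 0 ≤ t → ∀ k j, c ≤ φ ‖y t k - y t j‖) {t : ℝ} (ht : 0 ≤ t) :
    ∑ k, ‖y t k - m‖ ^ 2 ≤
      (∑ k, ‖y 0 k - m‖ ^ 2) * Real.exp (-(2 * c * Fintype.card ι * t)) := by
  set a : ℝ := 2 * c * Fintype.card ι with ha
  set V : ℝ → ℝ := fun s => ∑ k, ‖y s k - m‖ ^ 2 with hV
  have hder : ∀ s, 0 ≤ s → ∃ v, HasDerivAt V v s ∧ v ≤ -(a * V s) := fun s hs => by
    refine ⟨_, HasDerivAt.fun_sum (u := univ) fun k _ => ((hy s hs k).sub_const m).norm_sq, ?_⟩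
    have h := two_mul_sum_inner_sum_smul_sub (a := fun k j => φ ‖y s k - y s j‖)
      (fun k j => by rw [norm_sub_rev]) fun k => y s k - m
    simp only [sub_sub_sub_cancel_right] at h
    rw [← mul_sum, h, neg_le_neg_iff]
    have hvar := sum_sum_norm_sub_sq_of_sum_eq_zero (hm s hs)
    simp only [sub_sub_sub_cancel_right] at hvar
    calc a * V s = c * (2 * Fintype.card ι * ∑ k, ‖y s k - m‖ ^ 2) := by rw [ha, hV]; ring
      _ = ∑ k, ∑ j, c * ‖y s k - y s j‖ ^ 2 := by rw [← hvar]; simp only [mul_sum]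
      _ ≤ _ := sum_le_sum fun k _ => sum_le_sum fun j _ =>
        mul_le_mul_of_nonneg_right (hc s hs k j) (sq_nonneg _)
  have hexp : ∀ s, HasDerivAt (fun s => Real.exp (a * s)) (Real.exp (a * s) * a) s := fun s => by
    simpa using ((hasDerivAt_id s).const_mul a).exp
  have hanti : AntitoneOn (fun s => V s * Real.exp (a * s)) (Set.Ici 0) := by
    refine antitoneOn_of_deriv_nonpos (convex_Ici 0) ?_ ?_ ?_
    · intro s hs
      obtain ⟨v, hv, -⟩ := hder s hs
      exact (hv.mul (hexp s)).continuousAt.continuousWithinAt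
    · intro s hs
      obtain ⟨v, hv, -⟩ := hder s (interior_subset hs)
      exact (hv.mul (hexp s)).differentiableAt.differentiableWithinAt
    · intro s hs
      obtain ⟨v, hv, hle⟩ := hder s (interior_subset hs)
      rw [(hv.fun_mul (hexp s)).deriv]
      have := mul_nonneg (Real.exp_pos (a * s)).le (sub_nonneg.2 hle)
      linarith
  have h := hanti Set.self_mem_Ici ht ht
  simp only [mul_zero, Real.exp_zero, mul_one] at h
  rwa [Real.exp_neg, ← div_eq_mul_inv, le_div_iff₀ (Real.exp_pos _)]

/-- Particles which initially are all within interaction range converge to their mean. -/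
theorem tendsto_mean_of_particle_dynamics {r : ℝ} (hφ : ∀ s, 0 ≤ s → 0 ≤ φ s)
    (hφpos : ∀ s, 0 ≤ s → s < r → 0 < φ s) (hφmono : AntitoneOn φ (Set.Icc 0 r))
    (hy : ∀ t, 0 ≤ t → ∀ k,
      HasDerivAt (fun s => y s k) (∑ j, φ ‖y t k - y t j‖ • (y t j - y t k)) t)
    (hr : ∀ k j, ‖y 0 k - y 0 j‖ < r) (i : ι) :
    Tendsto (fun t => y t i) atTop (nhds ((Fintype.card ι : ℝ)⁻¹ • ∑ k, y 0 k)) := by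
  have : Nonempty ι := ⟨i⟩
  have hcard : (0 : ℝ) < Fintype.card ι := by exact_mod_cast Fintype.card_pos
  obtain ⟨p, hp⟩ := Finite.exists_max fun p : ι × ι => ‖y 0 p.1 - y 0 p.2‖
  set d := ‖y 0 p.1 - y 0 p.2‖
  have hd0 : 0 ≤ d := norm_nonneg _
  have hdr : d < r := hr _ _
  have hdist : ∀ t, 0 ≤ t → ∀ k j, ‖y t k - y t j‖ ≤ d := fun t ht =>
    norm_sub_le_of_particle_dynamics hφ hy (fun k j => hp (k, j)) ht
  have hc : ∀ t, 0 ≤ t → ∀ k j, φ d ≤ φ ‖y t k - y t j‖ := fun t ht k j =>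
    hφmono ⟨norm_nonneg _, (hdist t ht k j).trans hdr.le⟩ ⟨hd0, hdr.le⟩ (hdist t ht k j)
  set m := (Fintype.card ι : ℝ)⁻¹ • ∑ k, y 0 k with hmdef
  have hm : ∀ t, 0 ≤ t → ∑ k, (y t k - m) = 0 := fun t ht => by
    rw [sum_sub_distrib, sum_eq_of_particle_dynamics hy ht, sum_const, card_univ,
      ← Nat.cast_smul_eq_nsmul ℝ, hmdef, smul_inv_smul₀ hcard.ne', sub_self]
  have ha : 0 < 2 * φ d * Fintype.card ι :=
    mul_pos (mul_pos two_pos (hφpos d hd0 hdr)) hcard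
  have hlim : Tendsto (fun t => (∑ k, ‖y 0 k - m‖ ^ 2) *
      Real.exp (-(2 * φ d * Fintype.card ι * t))) atTop (nhds 0) := by
    simpa using (Real.tendsto_exp_neg_atTop_nhds_zero.comp
      (tendsto_id.const_mul_atTop ha)).const_mul (∑ k, ‖y 0 k - m‖ ^ 2)
  have hsq : Tendsto (fun t => ‖y t i - m‖ ^ 2) atTop (nhds 0) := by
    refine tendsto_of_tendsto_of_tendsto_of_le_of_le' tendsto_const_nhds hlim
      (Eventually.of_forall fun t => sq_nonneg _) ?_
    filter_upwards [eventually_ge_atTop 0] with t ht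
    exact (single_le_sum (f := fun k => ‖y t k - m‖ ^ 2) (fun k _ => sq_nonneg _)
      (mem_univ i)).trans (sum_norm_sub_mean_sq_le_of_particle_dynamics hy hm hc ht)
  rw [tendsto_iff_norm_sub_tendsto_zero]
  simpa using hsq.sqrt

end InnerProductSpace

/-- Main convergence theorem: under the cluster separation assumptions on the
data and the persistent inter-cluster separation along the solution, every
particle converges to the mean of the initial positions of its cluster. -/
theorem particles_converge_to_cluster_means
    {N M P : ℕ}
    (rstar : ℝ) (hrstar : 0 < rstar)
    (φ : ℝ → ℝ) (hφcont : Continuous φ)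
    (hφ01 : ∀ r : ℝ, 0 ≤ r → 0 ≤ φ r ∧ φ r ≤ 1)
    (hφzero : ∀ r : ℝ, rstar ≤ r → φ r = 0)
    (hφpos : ∀ r : ℝ, 0 ≤ r → r < rstar → 0 < φ r)
    (hφmono : AntitoneOn φ (Set.Icc 0 rstar))
    (z : Fin N → EuclideanSpace ℝ (Fin M))
    (I : Fin P → Finset (Fin N))
    (hne : ∀ ℓ, (I ℓ).Nonempty)
    (hdisj : ∀ ℓ m, ℓ ≠ m → Disjoint (I ℓ) (I m))
    (hcover : ∀ k : Fin N, ∃ ℓ, k ∈ I ℓ)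
    (hinter : ∀ ℓ m, ℓ ≠ m → ∀ i ∈ I ℓ, ∀ k ∈ I m, rstar < ‖z i - z k‖)
    (hintra : ∀ ℓ, ∀ i ∈ I ℓ, ∀ j ∈ I ℓ, ‖z i - z j‖ < rstar)
    (x : ℝ → Fin N → EuclideanSpace ℝ (Fin M))
    (hsol : ∀ t : ℝ, 0 ≤ t → ∀ k : Fin N,
      HasDerivAt (fun s => x s k)
        (∑ j : Fin N, φ ‖x t k - x t j‖ • (x t j - x t k)) t)
    (hinit : ∀ j : Fin N, x 0 j = z j)
    (hsep : ∀ t : ℝ, 0 ≤ t → ∀ ℓ m, ℓ ≠ m →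
      ∀ k ∈ I ℓ, ∀ j ∈ I m, rstar ≤ ‖x t k - x t j‖) :
    ∀ ℓ : Fin P, ∀ j ∈ I ℓ,
      Tendsto (fun t => x t j) atTop
        (nhds (((I ℓ).card : ℝ)⁻¹ • ∑ k ∈ I ℓ, z k)) := by
  intro ℓ j hj
  have hdyn : ∀ t, 0 ≤ t → ∀ k : I ℓ, HasDerivAt (fun s => x s k)
      (∑ i : I ℓ, φ ‖x t k - x t i‖ • (x t i - x t k)) t := fun t ht k => by
    rw [sum_coe_sort (I ℓ) fun i => φ ‖x t k - x t i‖ • (x t i - x t k),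
      sum_subset (subset_univ (I ℓ)) fun i _ hi => ?_]
    · exact hsol t ht k
    · obtain ⟨m, hm⟩ := hcover i
      have hlm : ℓ ≠ m := fun h => hi (h ▸ hm)
      rw [hφzero _ (hsep t ht ℓ m hlm k k.2 i hm), zero_smul]
  have h := tendsto_mean_of_particle_dynamics (y := fun t (k : I ℓ) => x t k)
    (fun r hr => (hφ01 r hr).1) hφpos hφmono hdyn
    (fun k i => by simpa only [hinit] using hintra ℓ k k.2 i i.2) ⟨j, hj⟩
  simpa only [hinit, Fintype.card_coe, sum_coe_sort (I ℓ) z] using h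
end

section
/- Let r* > 0 and let φ : ℝ → ℝ be a nonnegative function with φ(r) = 0 for all r ≥ r* and φ(r) > 0 for 0 < r < r*. Let I_ℓ ⊆ {1, …, N} with |I_ℓ| = n_ℓ, let x : [0, ∞) → (ℝ^M)^N be a solution of the particle dynamics, and let t ≥ 0 be a time at which ‖x_k(t) − x_j(t)‖ ≥ r* for all k ∈ I_ℓ, j ∉ I_ℓ, and at which there exist i, j ∈ I_ℓ with 0 < ‖x_i(t) − x_j(t)‖ < r*. Then the derivative at time t of the intra-cluster dispersion W_ℓ(s) = (1/2) Σ_{i ∈ I_ℓ} Σ_{j ∈ I_ℓ} ‖x_i(s) − x_j(s)‖² is strictly negative. -/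
open Finset

section WeightedSums

variable {ι E : Type*} [NormedAddCommGroup E] [InnerProductSpace ℝ E]

theorem sum_sum_smul_sub_eq_zero_s8 (I : Finset ι) (w : ι → ι → ℝ) (hw : ∀ i j, w i j = w j i)
    (x : ι → E) : ∑ i ∈ I, ∑ j ∈ I, w i j • (x j - x i) = 0 := by
  simp only [smul_sub, sum_sub_distrib]
  rw [sub_eq_zero, sum_comm]
  simp only [hw]

theorem sum_inner_sum_smul_sub (I : Finset ι) (w : ι → ι → ℝ) (hw : ∀ i j, w i j = w j i)
    (x : ι → E) :
    2 * ∑ i ∈ I, inner ℝ (x i) (∑ j ∈ I, w i j • (x j - x i)) =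
      -∑ i ∈ I, ∑ j ∈ I, w i j * ‖x i - x j‖ ^ 2 := by
  simp only [inner_sum, inner_smul_right]
  rw [two_mul]
  nth_rewrite 2 [sum_comm]
  simp only [← sum_add_distrib, ← sum_neg_distrib]
  refine sum_congr rfl fun i _ => sum_congr rfl fun j _ => ?_
  rw [hw j i, norm_sub_sq_real, inner_sub_right, inner_sub_right, real_inner_self_eq_norm_sq,
    real_inner_self_eq_norm_sq, real_inner_comm (x i) (x j)]
  ring

theorem sum_sum_inner_sub_sub (I : Finset ι) (x v : ι → E) (hv : ∑ i ∈ I, v i = 0) :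
    ∑ i ∈ I, ∑ j ∈ I, inner ℝ (x i - x j) (v i - v j) =
      2 * (#I : ℝ) * ∑ i ∈ I, inner ℝ (x i) (v i) := by
  have h1 : ∀ i, ∑ j ∈ I, inner ℝ (x i) (v j) = 0 := fun i => by
    rw [← inner_sum, hv, inner_zero_right]
  have h2 : ∑ i ∈ I, ∑ j ∈ I, inner ℝ (x j) (v i) = 0 := by
    rw [sum_comm]
    exact sum_eq_zero fun i _ => h1 i
  simp only [inner_sub_left, inner_sub_right, sum_sub_distrib, h1, h2, sum_const, nsmul_eq_mul,
    ← mul_sum]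
  ring

theorem hasDerivAt_half_sum_sum_norm_sub_sq (I : Finset ι) {x : ℝ → ι → E} {v : ι → E} {t : ℝ}
    (hx : ∀ i ∈ I, HasDerivAt (fun s => x s i) (v i) t) :
    HasDerivAt (fun s => (1 / 2 : ℝ) * ∑ i ∈ I, ∑ j ∈ I, ‖x s i - x s j‖ ^ 2)
      (∑ i ∈ I, ∑ j ∈ I, inner ℝ (x t i - x t j) (v i - v j)) t := by
  refine ((HasDerivAt.fun_sum fun i hi => HasDerivAt.fun_sum fun j hj =>
    ((hx i hi).fun_sub (hx j hj)).norm_sq).const_mul (1 / 2 : ℝ)).congr_deriv ?_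
  simp only [← mul_sum]
  ring

end WeightedSums

/-- Strict decrease of the intra-cluster dispersion: at any time where the
cluster is decoupled from the rest and not yet collapsed (two of its particles
are at positive distance below r*), the derivative of the intra-cluster
dispersion is strictly negative. -/
theorem intra_cluster_dispersion_strictly_decreasing
    {N M : ℕ}
    (rstar : ℝ) (hrstar : 0 < rstar)
    (φ : ℝ → ℝ) (hφ : ∀ r : ℝ, 0 ≤ φ r)
    (hφzero : ∀ r : ℝ, rstar ≤ r → φ r = 0)
    (hφpos : ∀ r : ℝ, 0 < r → r < rstar → 0 < φ r)
    (I : Finset (Fin N))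
    (x : ℝ → Fin N → EuclideanSpace ℝ (Fin M))
    (hsol : ∀ s : ℝ, 0 ≤ s → ∀ k : Fin N,
      HasDerivAt (fun u => x u k)
        (∑ j : Fin N, φ ‖x s k - x s j‖ • (x s j - x s k)) s)
    (t : ℝ) (ht : 0 ≤ t)
    (hsep : ∀ k ∈ I, ∀ j ∉ I, rstar ≤ ‖x t k - x t j‖)
    (hpair : ∃ i ∈ I, ∃ j ∈ I, 0 < ‖x t i - x t j‖ ∧ ‖x t i - x t j‖ < rstar) :
    deriv (fun s => (1 / 2 : ℝ) * ∑ i ∈ I, ∑ j ∈ I, ‖x s i - x s j‖ ^ 2) t < 0 := by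
  set w : Fin N → Fin N → ℝ := fun i j => φ ‖x t i - x t j‖ with hw_def
  have hw : ∀ i j, w i j = w j i := fun i j => by simp only [hw_def, norm_sub_rev]
  have hder : ∀ i ∈ I,
      HasDerivAt (fun u => x u i) (∑ j ∈ I, w i j • (x t j - x t i)) t := fun i hi => by
    convert hsol t ht i using 1
    refine sum_subset (subset_univ I) fun j _ hj => ?_
    rw [show w i j = 0 from hφzero _ (hsep i hi j hj), zero_smul]
  rw [(hasDerivAt_half_sum_sum_norm_sub_sq I hder).deriv,
    sum_sum_inner_sub_sub I _ _ (sum_sum_smul_sub_eq_zero_s8 I w hw (x t)),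
    mul_right_comm, sum_inner_sum_smul_sub I w hw, neg_mul, neg_lt_zero]
  obtain ⟨i, hi, j, hj, hpos, hlt⟩ := hpair
  have hnonneg : ∀ a b, 0 ≤ w a b * ‖x t a - x t b‖ ^ 2 := fun a b =>
    mul_nonneg (hφ _) (sq_nonneg _)
  refine mul_pos (sum_pos' (fun a _ => sum_nonneg fun b _ => hnonneg a b)
    ⟨i, hi, sum_pos' (fun b _ => hnonneg i b) ⟨j, hj, ?_⟩⟩) ?_
  · exact mul_pos (hφpos _ hpos hlt) (pow_pos hpos 2)
  · exact_mod_cast card_pos.mpr ⟨i, hi⟩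
end

section
/- Let r* > 0 and let φ : ℝ → ℝ be a nonnegative function with φ(r) = 0 for all r ≥ r*. Let I_ℓ ⊆ {1, …, N}, and let x : [0, ∞) → (ℝ^M)^N be a solution of the particle dynamics such that for every t ≥ 0, ‖x_k(t) − x_j(t)‖ ≥ r* whenever k ∈ I_ℓ and j ∉ I_ℓ. Then the intra-cluster distances never exceed their initial maximum: for every t ≥ 0 and all i, j ∈ I_ℓ, ‖x_i(t) − x_j(t)‖ ≤ max_{p, q ∈ I_ℓ} ‖x_p(0) − x_q(0)‖. In particular, if all intra-cluster distances are strictly less than r* at time 0, they remain strictly less than r* for all time. -/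
open Finset

open scoped RealInnerProductSpace Topology

/-- A finite maximum of differentiable functions does not increase if every function attaining
the maximum has nonpositive derivative there. -/
lemma sup'_le_of_hasDerivAt_nonpos {ι : Type*} {s : Finset ι} (hs : s.Nonempty)
    {g g' : ι → ℝ → ℝ} {a : ℝ}
    (hg : ∀ t, a ≤ t → ∀ p ∈ s, HasDerivAt (g p) (g' p t) t)
    (hmax : ∀ t, a ≤ t → ∀ p ∈ s, (∀ q ∈ s, g q t ≤ g p t) → g' p t ≤ 0)
    {t : ℝ} (ht : a ≤ t) :
    s.sup' hs (fun p => g p t) ≤ s.sup' hs (fun p => g p a) := by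
  refine image_le_of_liminf_slope_right_le_deriv_boundary
    (f := fun u => s.sup' hs (fun p => g p u)) (a := a) (b := t)
    (B := fun _ => s.sup' hs (fun p => g p a)) (B' := fun _ => 0)
    ?_ le_rfl continuousOn_const (fun u _ => hasDerivWithinAt_const _ _ _) ?_ ⟨ht, le_rfl⟩
  · exact ContinuousOn.finset_sup'_apply hs fun p hp u hu =>
      (hg u hu.1 p hp).continuousAt.continuousWithinAt
  · intro u hu r hr
    have key : ∀ p ∈ s, ∀ᶠ z in 𝓝[>] u,
        g p z < s.sup' hs (fun p => g p u) + r * (z - u) := by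
      intro p hp
      have hd := hg u hu.1 p hp
      rcases (le_sup' (fun p => g p u) hp).lt_or_eq with h | h
      · filter_upwards [(hd.continuousAt.eventually_lt_const h).filter_mono nhdsWithin_le_nhds,
          self_mem_nhdsWithin] with z hz hzu
        have := mul_pos hr (sub_pos.2 (Set.mem_Ioi.1 hzu))
        linarith
      · have hle : g' p u ≤ 0 := hmax u hu.1 p hp fun q hq =>
          (le_sup' (fun p => g p u) hq).trans h.ge
        have hslope := (hasDerivWithinAt_iff_tendsto_slope' Set.self_notMem_Ioi).1
          (hd.hasDerivWithinAt (s := Set.Ioi u))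
        filter_upwards [hslope.eventually_lt_const (hle.trans_lt hr),
          self_mem_nhdsWithin] with z hz hzu
        rw [slope_def_field, div_lt_iff₀ (sub_pos.2 hzu)] at hz
        linarith
    refine Filter.Eventually.frequently ?_
    filter_upwards [(Filter.eventually_all_finset s).2 key, self_mem_nhdsWithin] with z hz hzu
    rw [slope_def_field, div_lt_iff₀ (sub_pos.2 hzu), sub_lt_iff_lt_add',
      Finset.sup'_lt_iff]
    exact hz

/-- If no point `y j` with positive weight is farther from `b` than `a` is, then the weighted
sum of the differences `y j - a` does not point away from `b`. -/
lemma inner_sub_sum_smul_sub_nonpos {ι E : Type*} [NormedAddCommGroup E]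
    [InnerProductSpace ℝ E] (s : Finset ι) (w : ι → ℝ) (y : ι → E) (a b : E)
    (hw : ∀ j ∈ s, 0 ≤ w j) (h : ∀ j ∈ s, w j = 0 ∨ ‖y j - b‖ ≤ ‖a - b‖) :
    ⟪a - b, ∑ j ∈ s, w j • (y j - a)⟫ ≤ 0 := by
  rw [inner_sum]
  refine sum_nonpos fun j hj => ?_
  rw [inner_smul_right]
  rcases h j hj with h0 | hle
  · simp [h0]
  · refine mul_nonpos_of_nonneg_of_nonpos (hw j hj) ?_
    rw [← sub_sub_sub_cancel_right (y j) a b, inner_sub_right, real_inner_self_eq_norm_mul_norm]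
    have := real_inner_le_norm (a - b) (y j - b)
    have := mul_le_mul_of_nonneg_left hle (norm_nonneg (a - b))
    linarith

/-- If a cluster stays separated from the remaining particles, its
intra-cluster distances never exceed their initial maximum; in particular, if
all intra-cluster distances are initially strictly below r*, they remain so for
all time. -/
theorem intra_cluster_distances_bounded
    {N M : ℕ}
    (rstar : ℝ) (hrstar : 0 < rstar)
    (φ : ℝ → ℝ) (hφ : ∀ r : ℝ, 0 ≤ φ r)
    (hφzero : ∀ r : ℝ, rstar ≤ r → φ r = 0)
    (I : Finset (Fin N)) (hne : I.Nonempty)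
    (x : ℝ → Fin N → EuclideanSpace ℝ (Fin M))
    (hsol : ∀ t : ℝ, 0 ≤ t → ∀ k : Fin N,
      HasDerivAt (fun s => x s k)
        (∑ j : Fin N, φ ‖x t k - x t j‖ • (x t j - x t k)) t)
    (hsep : ∀ t : ℝ, 0 ≤ t → ∀ k ∈ I, ∀ j ∉ I, rstar ≤ ‖x t k - x t j‖) :
    (∀ t : ℝ, 0 ≤ t → ∀ i ∈ I, ∀ j ∈ I,
      ‖x t i - x t j‖ ≤
        (I ×ˢ I).sup' (hne.product hne) (fun pq => ‖x 0 pq.1 - x 0 pq.2‖)) ∧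
    ((∀ i ∈ I, ∀ j ∈ I, ‖x 0 i - x 0 j‖ < rstar) →
      ∀ t : ℝ, 0 ≤ t → ∀ i ∈ I, ∀ j ∈ I, ‖x t i - x t j‖ < rstar) := by
  have bound : ∀ t : ℝ, 0 ≤ t → ∀ i ∈ I, ∀ j ∈ I, ∃ pq ∈ I ×ˢ I,
      ‖x t i - x t j‖ ≤ ‖x 0 pq.1 - x 0 pq.2‖ := by
    intro t ht i hi j hj
    have hmono := sup'_le_of_hasDerivAt_nonpos (hne.product hne) (a := 0)
      (g := fun pq t => ‖x t pq.1 - x t pq.2‖ ^ 2)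
      (fun t ht pq _ => ((hsol t ht pq.1).sub (hsol t ht pq.2)).norm_sq) ?_ ht
    · obtain ⟨pq, hpq, heq⟩ := exists_mem_eq_sup' (hne.product hne)
        (fun pq : Fin N × Fin N => ‖x 0 pq.1 - x 0 pq.2‖ ^ 2)
      refine ⟨pq, hpq, (sq_le_sq₀ (norm_nonneg _) (norm_nonneg _)).1 ?_⟩
      rw [← heq]
      exact (le_sup' (fun pq : Fin N × Fin N => ‖x t pq.1 - x t pq.2‖ ^ 2)
        (mk_mem_product hi hj)).trans hmono
    · rintro t ht ⟨p, q⟩ hpq hmax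
      obtain ⟨hp, hq⟩ := mem_product.1 hpq
      have hdist : ∀ k ∈ I, ∀ l ∈ I, ‖x t k - x t l‖ ≤ ‖x t p - x t q‖ := fun k hk l hl =>
        (sq_le_sq₀ (norm_nonneg _) (norm_nonneg _)).1 (hmax (k, l) (mk_mem_product hk hl))
      have hweight : ∀ k ∈ I, ∀ l ∈ I, ∀ m, φ ‖x t k - x t m‖ = 0 ∨
          ‖x t m - x t l‖ ≤ ‖x t p - x t q‖ := fun k hk l hl m =>
        (em (m ∈ I)).elim (fun hm => .inr (hdist m hm l hl))
          fun hm => .inl (hφzero _ (hsep t ht k hk m hm))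
      have h₁ := inner_sub_sum_smul_sub_nonpos univ (fun m => φ ‖x t p - x t m‖) (x t)
        (x t p) (x t q) (fun _ _ => hφ _) fun m _ => hweight p hp q hq m
      have h₂ := inner_sub_sum_smul_sub_nonpos univ (fun m => φ ‖x t q - x t m‖) (x t)
        (x t q) (x t p) (fun _ _ => hφ _) fun m _ => by
          rw [norm_sub_rev (x t q) (x t p)]
          exact hweight q hq p hp m
      rw [← neg_sub (x t p) (x t q), inner_neg_left] at h₂
      simp only [Pi.sub_apply, inner_sub_right]
      linarith
  refine ⟨fun t ht i hi j hj => ?_, fun h0 t ht i hi j hj => ?_⟩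
  · obtain ⟨pq, hpq, hle⟩ := bound t ht i hi j hj
    exact hle.trans (le_sup' (fun pq : Fin N × Fin N => ‖x 0 pq.1 - x 0 pq.2‖) hpq)
  · obtain ⟨pq, hpq, hle⟩ := bound t ht i hi j hj
    obtain ⟨hp, hq⟩ := mem_product.1 hpq
    exact hle.trans_lt (h0 _ hp _ hq)
end

section
/- Fix σ > 0 and let x : ℝ → (ℝ^M)^N be a solution of the Gaussian-kernel particle dynamics ẋ_i = Σ_{k=1}^N exp(−‖x_k − x_i‖²/σ²)(x_k − x_i) for i = 1, …, N. For i, j ∈ {1, …, N} define the squared distances D_{ij}(t) = ‖x_i(t) − x_j(t)‖². Then each D_{ij} is differentiable and satisfies the closed, coordinate-free evolution equation D_{ij}'(t) = Σ_{k=1}^N [ e^{−D_{ik}(t)/σ²} (D_{jk}(t) − D_{ij}(t) − D_{ik}(t)) + e^{−D_{jk}(t)/σ²} (D_{ik}(t) − D_{ij}(t) − D_{jk}(t)) ]. In particular the evolution of the pairwise distances depends only on the pairwise distances themselves. -/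
open Finset

/-- The polarization identity turning the inner product of two edges at a common vertex into
squared side lengths. -/
theorem two_mul_inner_sub_sub {E : Type*} [NormedAddCommGroup E] [InnerProductSpace ℝ E]
    (a b c : E) :
    2 * inner ℝ (a - b) (c - a) = ‖b - c‖ ^ 2 - ‖a - b‖ ^ 2 - ‖a - c‖ ^ 2 := by
  have h := norm_add_sq_real (a - b) (c - a)
  rw [show a - b + (c - a) = c - b by abel, norm_sub_rev c b, norm_sub_rev c a] at h
  linarith

/-- Coordinate-free distance evolution for the Gaussian-kernel particle
dynamics: the squared pairwise distances D_{ij}(t) = ‖xᵢ(t) − xⱼ(t)‖² satisfy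
the closed system
D_{ij}' = Σₖ [ e^{−D_{ik}/σ²}(D_{jk} − D_{ij} − D_{ik})
             + e^{−D_{jk}/σ²}(D_{ik} − D_{ij} − D_{jk}) ]. -/
theorem gaussian_distance_evolution
    {N M : ℕ} (σ : ℝ) (hσ : 0 < σ)
    (x : ℝ → Fin N → EuclideanSpace ℝ (Fin M))
    (hsol : ∀ t : ℝ, ∀ i : Fin N,
      HasDerivAt (fun s => x s i)
        (∑ k : Fin N,
          Real.exp (-‖x t k - x t i‖ ^ 2 / σ ^ 2) • (x t k - x t i)) t) :
    ∀ (t : ℝ) (i j : Fin N),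
      HasDerivAt (fun s => ‖x s i - x s j‖ ^ 2)
        (∑ k : Fin N,
          (Real.exp (-‖x t i - x t k‖ ^ 2 / σ ^ 2) *
              (‖x t j - x t k‖ ^ 2 - ‖x t i - x t j‖ ^ 2 - ‖x t i - x t k‖ ^ 2) +
            Real.exp (-‖x t j - x t k‖ ^ 2 / σ ^ 2) *
              (‖x t i - x t k‖ ^ 2 - ‖x t i - x t j‖ ^ 2 - ‖x t j - x t k‖ ^ 2))) t := by
  intro t i j
  convert ((hsol t i).fun_sub (hsol t j)).norm_sq using 1
  rw [← Finset.sum_sub_distrib, inner_sum, Finset.mul_sum]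
  refine Finset.sum_congr rfl fun k _ => ?_
  have hj := two_mul_inner_sub_sub (x t j) (x t i) (x t k)
  rw [norm_sub_rev (x t j) (x t i), ← neg_sub (x t i) (x t j), inner_neg_left] at hj
  rw [← two_mul_inner_sub_sub, ← hj, inner_sub_right _ (_ • _), real_inner_smul_right,
    real_inner_smul_right, norm_sub_rev (x t k) (x t i), norm_sub_rev (x t k) (x t j)]
  ring
end
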